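/- Let g, d, G be real numbers with g > 0, d ≥ 2g, G ≥ 2 and G ≥ d/g; let I ≥ 0 and let c be a real number with 0 < c ≤ 1/4. Then (d - I/(1-2c)) / ( I/g + (G/(g·(G-1)))·h₂(g·c/d)/(1-2c) ) ≥ d / ( I/g + (1/(2·(d-g)·ln 2))·(ln(4d/g) + 8/7) ) - 2g. -/

import Mathlib

/-- The binary entropy function `h₂(x) = -x·log₂ x - (1-x)·log₂(1-x)`,
with the convention `0·log₂ 0 = 0` (automatic since `Real.logb 2 0 = 0`). -/
noncomputable def binEnt (x : ℝ) : ℝ :=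
  -x * Real.logb 2 x - (1 - x) * Real.logb 2 (1 - x)

theorem binEnt_eq_binEntropy_div_log_two (x : ℝ) : binEnt x = Real.binEntropy x / Real.log 2 := by
  rw [binEnt, Real.binEntropy, Real.logb, Real.logb, Real.log_inv, Real.log_inv]
  ring

theorem Real.binEntropy_le_mul_log_inv_add_one {x : ℝ} (hx : x < 1) :
    Real.binEntropy x ≤ x * (Real.log x⁻¹ + 1) := by
  have hx' : 0 < 1 - x := sub_pos.2 hx
  have hlog := Real.log_le_sub_one_of_pos (inv_pos.2 hx')
  have hmul := mul_le_mul_of_nonneg_left hlog hx'.le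
  rw [mul_sub, mul_inv_cancel₀ hx'.ne'] at hmul
  rw [Real.binEntropy]
  linarith

theorem binEnt_pos {x : ℝ} (hx0 : 0 < x) (hx1 : x < 1) : 0 < binEnt x := by
  rw [binEnt_eq_binEntropy_div_log_two]
  exact div_pos (Real.binEntropy_pos hx0 hx1) (Real.log_pos one_lt_two)

theorem binEnt_mul_div_le {g d c : ℝ} (hg : 0 < g) (hd : 2 * g ≤ d) (hc0 : 0 < c)
    (hc : c ≤ 1 / 4) :
    binEnt (g * c / d) ≤ g / (4 * d * Real.log 2) * (Real.log (4 * d / g) + 8 / 7) := by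
  have hd0 : 0 < d := by linarith
  have hl2 : 0 < Real.log 2 := Real.log_pos one_lt_two
  have hle : g * c / d ≤ g / (4 * d) := by
    rw [div_le_div_iff₀ hd0 (by positivity)]
    nlinarith [mul_pos hg hd0]
  have hx : g / (4 * d) ≤ 2⁻¹ := by
    rw [div_le_iff₀ (by positivity)]
    linarith
  have hmono := Real.binEntropy_strictMonoOn.monotoneOn
    ⟨by positivity, hle.trans hx⟩ ⟨by positivity, hx⟩ hle
  have hbound := Real.binEntropy_le_mul_log_inv_add_one (x := g / (4 * d)) (by linarith)
  rw [inv_div] at hbound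
  rw [binEnt_eq_binEntropy_div_log_two, div_le_iff₀ hl2]
  calc Real.binEntropy (g * c / d)
      ≤ g / (4 * d) * (Real.log (4 * d / g) + 1) := hmono.trans hbound
    _ ≤ g / (4 * d) * (Real.log (4 * d / g) + 8 / 7) := by gcongr; norm_num
    _ = g / (4 * d * Real.log 2) * (Real.log (4 * d / g) + 8 / 7) * Real.log 2 := by
      field_simp

theorem div_mul_sub_one_le {g d G : ℝ} (hg : 0 < g) (hgd : g < d) (hG : d / g ≤ G) :
    G / (g * (G - 1)) ≤ d / (g * (d - g)) := by
  have hG' : d ≤ G * g := (div_le_iff₀ hg).1 hG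
  have hG1 : 0 < G - 1 := sub_pos.2 (((one_lt_div hg).2 hgd).trans_le hG)
  have hdg : 0 < d - g := sub_pos.2 hgd
  rw [div_le_div_iff₀ (by positivity) (by positivity)]
  nlinarith [mul_le_mul_of_nonneg_left hG' hg.le]

/-- Arithmetic reduction from the bound of Theorem 1 to the bound of
Proposition 1: for reals `g > 0`, `d ≥ 2g`, `G ≥ 2`, `G ≥ d/g`, `I ≥ 0` and
`0 < c ≤ 1/4`,
`(d - I/(1-2c)) / (I/g + (G/(g·(G-1)))·h₂(g·c/d)/(1-2c))
  ≥ d/(I/g + (1/(2·(d-g)·ln 2))·(ln(4d/g) + 8/7)) - 2g`. -/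
theorem bound_reduction (g d G I c : ℝ)
    (hg : 0 < g) (hd : d ≥ 2 * g) (hG2 : G ≥ 2) (hGdg : G ≥ d / g)
    (hI : 0 ≤ I) (hc0 : 0 < c) (hc : c ≤ 1 / 4) :
    (d - I / (1 - 2 * c)) /
        (I / g + G / (g * (G - 1)) * binEnt (g * c / d) / (1 - 2 * c))
      ≥ d / (I / g + 1 / (2 * (d - g) * Real.log 2) * (Real.log (4 * d / g) + 8 / 7))
        - 2 * g := by
  have hd0 : 0 < d := by linarith
  have hdg : 0 < d - g := by linarith
  have hG1 : 0 < G - 1 := by linarith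
  have hc2 : 0 < 1 - 2 * c := by linarith
  have hl2 : 0 < Real.log 2 := Real.log_pos one_lt_two
  have hentropy := binEnt_mul_div_le hg hd hc0 hc
  have hentropy_pos : 0 < binEnt (g * c / d) := by
    apply binEnt_pos (by positivity)
    rw [div_lt_one hd0]
    nlinarith
  have hinv : (1 - 2 * c)⁻¹ ≤ 2 := by
    rw [inv_le_comm₀ hc2 two_pos]
    linarith
  have hcoeff := div_mul_sub_one_le hg (by linarith) hGdg
  set A := G / (g * (G - 1)) * binEnt (g * c / d) / (1 - 2 * c) with hA
  set B := 1 / (2 * (d - g) * Real.log 2) * (Real.log (4 * d / g) + 8 / 7) with hB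
  have hA_pos : 0 < A := by positivity
  have hAB : A ≤ B := by
    calc A = G / (g * (G - 1)) * binEnt (g * c / d) * (1 - 2 * c)⁻¹ := div_eq_mul_inv _ _
      _ ≤ d / (g * (d - g)) *
          (g / (4 * d * Real.log 2) * (Real.log (4 * d / g) + 8 / 7)) * 2 := by
        gcongr
        exact mul_nonneg (by positivity) (hentropy_pos.le.trans hentropy)
      _ = B := by
        rw [hB]
        field_simp
        ring
  have hIg : 0 ≤ I / g := by positivity
  have hdenom : 0 < I / g + A := by positivity
  have hloss : I / (1 - 2 * c) ≤ 2 * g * (I / g + A) := by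
    calc I / (1 - 2 * c) = I * (1 - 2 * c)⁻¹ := div_eq_mul_inv _ _
      _ ≤ I * 2 := by gcongr
      _ = 2 * g * (I / g) := by field_simp
      _ ≤ 2 * g * (I / g + A) := by gcongr; linarith
  calc d / (I / g + B) - 2 * g ≤ d / (I / g + A) - 2 * g := by gcongr
    _ ≤ (d - I / (1 - 2 * c)) / (I / g + A) := by
      rw [sub_div]
      gcongr
      rwa [div_le_iff₀ hdenom]
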